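/- arXiv:math/0411440 — 2 statements merged into one kernel-verified Lean document; each statement's English description precedes it below -/
import Mathlib

section
/- Let A be a unital associative ℚ(q)-algebra and a, b, c, d ∈ A satisfying ab = qba, ac = qca, bd = qdb, cd = qdc, bc = cb, ad − da = (q − q^{−1})bc and ad − qbc = 1 (the defining relations of the quantum function algebra F_q[SL_2]). Then for every n ∈ ℕ: a^n d^n = Σ_{k=0}^{n} q^{k²} binom_{q²}(n,k) b^k c^k, where binom_{q²}(n,k) is the q-binomial coefficient with q replaced by q². -/
open Finset

noncomputable section

/-- The base field `ℚ(q)` of rational functions over `ℚ`. -/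
abbrev K : Type := RatFunc ℚ

/-- The indeterminate `q`. -/
def q : K := RatFunc.X

/-- The `x`-number `(n)_x = (x^n - 1)/(x - 1)`. -/
def qn (x : K) (n : ℕ) : K := (x ^ n - 1) / (x - 1)

/-- The `x`-factorial `(n)_x!`. -/
def qnFact (x : K) (n : ℕ) : K := ∏ r ∈ Finset.Icc 1 n, qn x r

/-- The `x`-binomial coefficient `binom_x(n,s)`, zero when `s > n`. -/
def qBinom (x : K) (n s : ℕ) : K :=
  if s ≤ n then qnFact x n / (qnFact x s * qnFact x (n - s)) else 0

/-- The balanced `q`-integer `[n]_q = (q^n - q^{-n})/(q - q^{-1})`. -/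
def qint (n : ℕ) : K := (q ^ n - q⁻¹ ^ n) / (q - q⁻¹)

/-- The balanced `q`-factorial `[n]_q!`. -/
def qintFact (n : ℕ) : K := ∏ r ∈ Finset.Icc 1 n, qint r

variable {A : Type*} [Ring A] [Algebra K A]

/-- The `q`-divided power `X^{(n)} = X^n / [n]_q!`. -/
def dp (X : A) (n : ℕ) : A := (qintFact n)⁻¹ • X ^ n

/-- The `q`-binomial coefficient `C_q(X; c, n) = ∏_{s=1}^n (q^{c+1-s} X - 1)/(q^s - 1)`. -/
def Cq (X : A) (c : ℤ) : ℕ → A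
  | 0 => 1
  | n + 1 => (q ^ ((n : ℤ) + 1) - 1)⁻¹ • (Cq X c n * (q ^ (c - (n : ℤ)) • X - 1))

/-- The bracket `{X; c | n, r} = Σ_{s=0}^r q^{s(s+1)/2} binom_q(r,s) C_q(X; c+s, n-r)`. -/
def Sq (X : A) (c : ℤ) (n r : ℕ) : A :=
  ∑ s ∈ Finset.range (r + 1),
    (q ^ (s * (s + 1) / 2) * qBinom q r s) • Cq X (c + (s : ℤ)) (n - r)

end

theorem q_pow_ne_one {n : ℕ} (hn : n ≠ 0) : q ^ n ≠ 1 := by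
  intro h
  have h' : algebraMap (Polynomial ℚ) (RatFunc ℚ) (Polynomial.X ^ n) =
      algebraMap (Polynomial ℚ) (RatFunc ℚ) 1 := by
    rw [map_pow, map_one, RatFunc.algebraMap_X]
    exact h
  have hX := congrArg Polynomial.natDegree (RatFunc.algebraMap_injective ℚ h')
  rw [Polynomial.natDegree_X_pow, Polynomial.natDegree_one] at hX
  exact hn hX

theorem qnFact_zero (x : K) : qnFact x 0 = 1 := by
  simp [qnFact]

theorem qnFact_succ (x : K) (n : ℕ) : qnFact x (n + 1) = qnFact x n * qn x (n + 1) := by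
  rw [qnFact, Finset.prod_Icc_succ_top (by lia), qnFact]

theorem qn_ne_zero {x : K} (hx : ∀ n : ℕ, n ≠ 0 → x ^ n ≠ 1) {n : ℕ} (hn : n ≠ 0) :
    qn x n ≠ 0 :=
  div_ne_zero (sub_ne_zero.2 (hx n hn)) (sub_ne_zero.2 (by simpa using hx 1 one_ne_zero))

theorem qnFact_ne_zero {x : K} (hx : ∀ n : ℕ, n ≠ 0 → x ^ n ≠ 1) (n : ℕ) : qnFact x n ≠ 0 :=
  Finset.prod_ne_zero_iff.2 fun r hr ↦ qn_ne_zero hx (by have := Finset.mem_Icc.1 hr; lia)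

theorem qn_add (x : K) (m n : ℕ) : qn x (m + n) = qn x m + x ^ m * qn x n := by
  simp only [qn, pow_add]
  ring

theorem qBinom_add (x : K) (k j : ℕ) :
    qBinom x (k + j) k = qnFact x (k + j) / (qnFact x k * qnFact x j) := by
  simp [qBinom]

theorem qBinom_eq_zero (x : K) {n k : ℕ} (h : n < k) : qBinom x n k = 0 :=
  if_neg (by lia)

theorem qBinom_zero_right {x : K} (hx : ∀ n : ℕ, n ≠ 0 → x ^ n ≠ 1) (n : ℕ) :
    qBinom x n 0 = 1 := by
  simp [qBinom, qnFact_zero, qnFact_ne_zero hx]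

theorem qBinom_self {x : K} (hx : ∀ n : ℕ, n ≠ 0 → x ^ n ≠ 1) (n : ℕ) :
    qBinom x n n = 1 := by
  simp [qBinom, qnFact_zero, qnFact_ne_zero hx]

/-- The Pascal rule for `x`-binomial coefficients. -/
theorem qBinom_succ_succ {x : K} (hx : ∀ n : ℕ, n ≠ 0 → x ^ n ≠ 1) (k j : ℕ) :
    qBinom x (k + j + 1) (k + 1) = qBinom x (k + j) (k + 1) + x ^ j * qBinom x (k + j) k := by
  rcases j with _ | j
  · simp [qBinom_self hx, qBinom_eq_zero]
  · have h₁ : qBinom x (k + (j + 1) + 1) (k + 1) =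
        qnFact x (k + (j + 1) + 1) / (qnFact x (k + 1) * qnFact x (j + 1)) := by
      rw [← add_right_comm, qBinom_add]
    have h₂ : qBinom x (k + (j + 1)) (k + 1) =
        qnFact x (k + (j + 1)) / (qnFact x (k + 1) * qnFact x j) := by
      rw [show k + (j + 1) = k + 1 + j by ring, qBinom_add]
    rw [h₁, h₂, qBinom_add, qnFact_succ x (k + (j + 1)),
      show k + (j + 1) + 1 = (j + 1) + (k + 1) by ring, qn_add, qnFact_succ x k, qnFact_succ x j]
    have hk := qnFact_ne_zero hx k
    have hj := qnFact_ne_zero hx j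
    have hk' := qn_ne_zero hx k.succ_ne_zero
    have hj' := qn_ne_zero hx j.succ_ne_zero
    field_simp

/-- The step of the `q`-binomial theorem (with base `q ^ 2`). -/
theorem one_add_smul_mul_sum_qBinom {A : Type*} [Ring A] [Algebra K A] (y : A) (n : ℕ) :
    (1 + q ^ (2 * n + 1) • y) *
        ∑ k ∈ Finset.range (n + 1), (q ^ (k ^ 2) * qBinom (q ^ 2) n k) • y ^ k =
      ∑ k ∈ Finset.range (n + 2), (q ^ (k ^ 2) * qBinom (q ^ 2) (n + 1) k) • y ^ k := by
  have hq : ∀ m : ℕ, m ≠ 0 → (q ^ 2) ^ m ≠ 1 := fun m hm ↦ by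
    rw [← pow_mul]
    exact q_pow_ne_one (by lia)
  have hpascal : ∀ k ∈ Finset.range (n + 1),
      (q ^ ((k + 1) ^ 2) * qBinom (q ^ 2) (n + 1) (k + 1)) • y ^ (k + 1) =
        (q ^ ((k + 1) ^ 2) * qBinom (q ^ 2) n (k + 1)) • y ^ (k + 1) +
          q ^ (2 * n + 1) • y * (q ^ (k ^ 2) * qBinom (q ^ 2) n k) • y ^ k := by
    intro k hk
    obtain ⟨j, rfl⟩ := Nat.exists_eq_add_of_le (Nat.lt_succ_iff.1 (Finset.mem_range.1 hk))
    rw [qBinom_succ_succ hq, smul_mul_smul_comm, ← pow_succ', ← add_smul]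
    congr 1
    ring
  have htop : ∑ k ∈ Finset.range (n + 1), (q ^ (k ^ 2) * qBinom (q ^ 2) n k) • y ^ k =
      ∑ k ∈ Finset.range (n + 2), (q ^ (k ^ 2) * qBinom (q ^ 2) n k) • y ^ k := by
    rw [Finset.sum_range_succ _ (n + 1), qBinom_eq_zero _ n.lt_succ_self, mul_zero, zero_smul,
      add_zero]
  rw [Finset.sum_range_succ' _ (n + 1), Finset.sum_congr rfl hpascal, Finset.sum_add_distrib,
    ← Finset.mul_sum, add_mul, one_mul]
  nth_rewrite 1 [htop]
  rw [Finset.sum_range_succ' _ (n + 1), qBinom_zero_right hq, qBinom_zero_right hq]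
  abel

theorem pow_mul_eq_smul_mul_pow {A : Type*} [Ring A] [Algebra K A] {a y : A} {r : K}
    (h : a * y = r • (y * a)) (n : ℕ) : a ^ n * y = r ^ n • (y * a ^ n) := by
  induction n with
  | zero => simp
  | succ n ih =>
    rw [pow_succ, mul_assoc, h, mul_smul_comm, ← mul_assoc, ih, smul_mul_assoc, smul_smul,
      mul_assoc, ← pow_succ']

theorem statement7 {A : Type*} [Ring A] [Algebra K A] (a b c d : A)
    (hab : a * b = (q : K) • (b * a)) (hac : a * c = (q : K) • (c * a))
    (hbd : b * d = (q : K) • (d * b)) (hcd : c * d = (q : K) • (d * c))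
    (hbc : b * c = c * b)
    (hcomm : a * d - d * a = ((q - q⁻¹ : K)) • (b * c))
    (hdet : a * d - (q : K) • (b * c) = 1) (n : ℕ) :
    a ^ n * d ^ n =
      ∑ k ∈ Finset.range (n + 1),
        (q ^ (k ^ 2) * qBinom (q ^ 2) n k) • (b ^ k * c ^ k) := by
  have hy : a * (b * c) = (q ^ 2) • (b * c * a) := by
    rw [← mul_assoc, hab, smul_mul_assoc, mul_assoc, hac, mul_smul_comm, smul_smul, ← mul_assoc,
      ← sq]
  simp_rw [← (show Commute b c from hbc).mul_pow]
  induction n with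
  | zero => simp [qBinom, qnFact_zero]
  | succ n ih =>
    rw [← one_add_smul_mul_sum_qBinom, ← ih, pow_succ a, pow_succ' d, mul_assoc, ← mul_assoc a d,
      sub_eq_iff_eq_add.1 hdet, ← mul_assoc, ← mul_assoc, mul_add, mul_one, mul_smul_comm,
      pow_mul_eq_smul_mul_pow hy, smul_smul, ← pow_mul, ← pow_succ']
    simp only [add_mul, one_mul, smul_mul_assoc]
end

section
/- Let A be a unital associative ℚ(q)-algebra and a, b, c, d ∈ A satisfying the defining relations of Manin's quantum 2×2 matrix algebra F_q[M_2]: ab = qba, ac = qca, bd = qdb, cd = qdc, bc = cb, ad − da = (q − q^{−1})bc. Set 𝐛 := (q − q^{−1})^{−1} b and 𝐜 := (q − q^{−1})^{−1} c. Then for all u ∈ ℕ with u ≥ 1 and all ℓ ∈ ℤ: C_q(a; ℓ, u) · d − d · C_q(a; ℓ, u) = q^{ℓ−u} (q − q^{−1})² · 𝐜 𝐛 · {a; ℓ | u, 1}. -/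
open Finset

theorem q_ne_zero : q ≠ 0 := RatFunc.X_ne_zero

theorem q_pow_sub_one_ne_zero (n : ℕ) : q ^ ((n : ℤ) + 1) - 1 ≠ 0 := by
  have h : (Polynomial.X ^ (n + 1) - 1 : Polynomial ℚ) ≠ 0 :=
    (Polynomial.monic_X_pow_sub_C 1 n.succ_ne_zero).ne_zero
  have h' := (map_ne_zero_iff _ (RatFunc.algebraMap_injective ℚ)).mpr h
  rw [map_sub, map_pow, RatFunc.algebraMap_X, map_one] at h'
  exact_mod_cast h'

theorem q_sub_inv_ne_zero : q - q⁻¹ ≠ 0 := by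
  have h := q_pow_sub_one_ne_zero 1
  have h0 := q_ne_zero
  intro h'
  apply h
  have h2 : q * (q - q⁻¹) = 0 := by rw [h', mul_zero]
  rw [mul_sub, mul_inv_cancel₀ h0] at h2
  norm_num
  linear_combination h2

section Commutative

variable {R : Type*} [CommRing R] [Algebra K R] (X : R)

/-- The defining product of `Cq`, with its top factor split off on the left. -/
theorem Cq_add_one_succ (c : ℤ) (n : ℕ) :
    Cq X (c + 1) (n + 1) =
      (q ^ ((n : ℤ) + 1) - 1)⁻¹ • ((q ^ (c + 1) • X - 1) * Cq X c n) := by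
  induction n with
  | zero => simp [Cq]
  | succ n ih =>
    rw [Cq, ih, Cq]
    simp only [Nat.cast_add, Nat.cast_one, smul_mul_assoc, mul_smul_comm, add_sub_add_right_eq_sub]
    rw [mul_assoc]

/-- The `q`-Pascal identity. -/
theorem Cq_add_one_succ_sub (c : ℤ) (n : ℕ) :
    Cq X (c + 1) (n + 1) - Cq X c (n + 1) = q ^ (c - (n : ℤ)) • (X * Cq X c n) := by
  have hq := q_pow_sub_one_ne_zero n
  rw [Cq_add_one_succ, Cq, ← smul_sub, inv_smul_eq_iff₀ hq, smul_smul,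
    sub_mul (q ^ ((n : ℤ) + 1)), ← zpow_add₀ q_ne_zero, one_mul]
  have : (n : ℤ) + 1 + (c - n) = c + 1 := by ring
  rw [this, sub_smul]
  simp only [Algebra.smul_def]
  ring

end Commutative

theorem map_Cq {R S : Type*} [Ring R] [Algebra K R] [Ring S] [Algebra K S] (φ : R →ₐ[K] S)
    (X : R) (c : ℤ) (n : ℕ) : φ (Cq X c n) = Cq (φ X) c n := by
  induction n with
  | zero => simp [Cq]
  | succ n ih => simp [Cq, ih]

theorem Cq_zpow_smul {R : Type*} [Ring R] [Algebra K R] (X : R) (k c : ℤ) (n : ℕ) :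
    Cq (q ^ k • X) c n = Cq X (c + k) n := by
  induction n with
  | zero => rfl
  | succ n ih =>
    rw [Cq, Cq, ih, smul_smul, ← zpow_add₀ q_ne_zero, sub_add_eq_add_sub]

theorem pow_mul_eq_smul {A : Type*} [Ring A] [Algebra K A] {a x : A} {t : K}
    (h : a * x = t • (x * a)) (n : ℕ) : a ^ n * x = t ^ n • (x * a ^ n) := by
  induction n with
  | zero => simp
  | succ n ih =>
    rw [pow_succ, mul_assoc, h, mul_smul_comm, ← mul_assoc, ih, smul_mul_assoc, smul_smul,
      mul_assoc, pow_succ' t]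

/-- If `a` `t`-commutes with `x`, and `a * d - d * a = (t - 1) • x`, then `p(a)` fails to commute
with `d` by `x` times the difference quotient of `p` at `t X` and `X`. -/
theorem aeval_mul_sub_mul_aeval {A : Type*} [Ring A] [Algebra K A] {a d x : A} {t : K}
    (hx : a * x = t • (x * a)) (hd : a * d - d * a = (t - 1) • x) (p : Polynomial K) :
    Polynomial.aeval a p * d - d * Polynomial.aeval a p =
      x * Polynomial.aeval a (p.comp (t • Polynomial.X) - p).divX := by
  induction p using Polynomial.induction_on' with
  | add p r hp hr =>
    rw [Polynomial.add_comp, add_sub_add_comm, Polynomial.divX_add, map_add, map_add, mul_add,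
      add_mul, mul_add, add_sub_add_comm, hp, hr]
  | monomial n r =>
    have key : ∀ n : ℕ, a ^ (n + 1) * d - d * a ^ (n + 1) = (t ^ (n + 1) - 1) • (x * a ^ n) := by
      intro n
      induction n with
      | zero => simpa using hd
      | succ n ih =>
        have hd' : a * d = d * a + (t - 1) • x := by rw [← hd]; abel
        rw [pow_succ a (n + 1), mul_assoc, hd', mul_add, mul_smul_comm, pow_mul_eq_smul hx,
          add_sub_right_comm, ← mul_assoc, ← mul_assoc, ← sub_mul, ih, smul_mul_assoc, smul_smul,
          mul_assoc, ← pow_succ, ← add_smul]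
        congr 1
        ring
    cases n with
    | zero => simp [Algebra.commutes]
    | succ n =>
      have h : (Polynomial.monomial (n + 1) r).comp (t • Polynomial.X) -
          Polynomial.monomial (n + 1) r =
            Polynomial.C (r * (t ^ (n + 1) - 1)) * Polynomial.X ^ (n + 1) := by
        rw [← Polynomial.C_mul_X_pow_eq_monomial, Polynomial.smul_eq_C_mul]
        simp
        ring
      rw [h, Polynomial.divX_C_mul_X_pow, if_neg n.succ_ne_zero]
      simp only [Polynomial.aeval_monomial, map_mul, Polynomial.aeval_C, map_pow,
        Polynomial.aeval_X, Nat.add_sub_cancel]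
      rw [← map_mul, ← Algebra.smul_def, ← Algebra.smul_def, smul_mul_assoc, mul_smul_comm,
        ← smul_sub, key, mul_smul_comm, smul_smul]

theorem divX_mul_X {R : Type*} [Semiring R] (p : Polynomial R) :
    (p * Polynomial.X).divX = p := by
  ext n
  rw [Polynomial.coeff_divX, Polynomial.coeff_mul_X]

theorem Sq_succ_one {A : Type*} [Ring A] [Algebra K A] (X : A) (c : ℤ) (n : ℕ) :
    Sq X c (n + 1) 1 = Cq X c n + q • Cq X (c + 1) n := by
  have h : q - 1 ≠ 0 := by simpa using q_pow_sub_one_ne_zero 0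
  simp [Sq, Finset.sum_range_succ, qBinom, qnFact, qn, h]

theorem statement15 {A : Type*} [Ring A] [Algebra K A] (a b c d : A)
    (hab : a * b = (q : K) • (b * a)) (hac : a * c = (q : K) • (c * a))
    (hbd : b * d = (q : K) • (d * b)) (hcd : c * d = (q : K) • (d * c))
    (hbc : b * c = c * b)
    (hcomm : a * d - d * a = ((q - q⁻¹ : K)) • (b * c))
    (u : ℕ) (hu : 1 ≤ u) (l : ℤ) :
    Cq a l u * d - d * Cq a l u =
      (q ^ (l - (u : ℤ)) * (q - q⁻¹) ^ 2) •
        (((q - q⁻¹ : K)⁻¹ • c) * ((q - q⁻¹ : K)⁻¹ • b) * Sq a l u 1) := by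
  obtain ⟨n, rfl⟩ := Nat.exists_eq_add_of_le' hu
  have hq := q_ne_zero
  have hx : a * (q⁻¹ • (b * c)) = q ^ 2 • ((q⁻¹ • (b * c)) * a) := by
    rw [mul_smul_comm, ← mul_assoc, hab, smul_mul_assoc, mul_assoc b a c, hac, smul_mul_assoc,
      mul_smul_comm, smul_smul, smul_smul, smul_smul, mul_assoc b c a]
    congr 1
    ring
  have hd : a * d - d * a = (q ^ 2 - 1) • (q⁻¹ • (b * c)) := by
    rw [hcomm, smul_smul]
    congr 1
    field_simp
  have hdiff : (Cq (Polynomial.X : Polynomial K) l (n + 1)).comp (q ^ 2 • Polynomial.X) -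
      Cq Polynomial.X l (n + 1) = q ^ (l - (n : ℤ)) • Sq Polynomial.X l (n + 1) 1 *
        Polynomial.X := by
    have hcomp : (Cq (Polynomial.X : Polynomial K) l (n + 1)).comp (q ^ 2 • Polynomial.X) =
        Cq Polynomial.X (l + 1 + 1) (n + 1) := by
      rw [Polynomial.comp_eq_aeval, map_Cq, Polynomial.aeval_X, ← zpow_natCast, Cq_zpow_smul,
        add_assoc]
      rfl
    rw [hcomp, ← sub_add_sub_cancel _ (Cq Polynomial.X (l + 1) (n + 1)), Cq_add_one_succ_sub,
      Cq_add_one_succ_sub, Sq_succ_one, add_sub_right_comm, zpow_add_one₀ hq, smul_add, smul_smul,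
      add_mul, smul_mul_assoc, smul_mul_assoc, mul_comm Polynomial.X, mul_comm Polynomial.X,
      add_comm]
  have hmain := aeval_mul_sub_mul_aeval hx hd (Cq Polynomial.X l (n + 1))
  rw [hdiff, divX_mul_X, map_smul, Sq_succ_one, map_add, map_smul] at hmain
  simp only [map_Cq, Polynomial.aeval_X] at hmain
  rw [hmain, Sq_succ_one, hbc]
  simp only [smul_mul_assoc, mul_smul_comm, smul_smul]
  congr 1
  have hq' := q_sub_inv_ne_zero
  rw [Nat.cast_add, Nat.cast_one, ← sub_sub, zpow_sub_one₀ hq]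
  generalize q - q⁻¹ = e at hq'
  field_simp
end
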